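/- arXiv:2405.10588 — 2 statements merged into one kernel-verified Lean document; each statement's English description precedes it below -/
import Mathlib

section
/- (Parseval's theorem for the Mellin transform.) Let f : (0,∞) → ℂ be measurable such that x ↦ f(x)/x belongs to L¹((0,∞)) and ∫_0^∞ |f(x)|²/x dx < ∞. Then ∫_0^∞ |f(x)|²/x dx = (1/2π) ∫_{−∞}^{∞} |M[f](it)|² dt, where M[f](it) = ∫_0^∞ x^{it−1} f(x) dx. -/
open MeasureTheory

open scoped FourierTransform ContDiff

/-- The `L²` Fourier transform agrees almost everywhere with the Fourier integral on `L¹ ∩ L²`. -/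
theorem coeFn_fourier_toLp_ae_eq {g : ℝ → ℂ} (hg1 : Integrable g) (hg2 : MemLp g 2) :
    (𝓕 (hg2.toLp g) : Lp ℂ 2 (volume : Measure ℝ)) =ᵐ[volume] 𝓕 g := by
  have hcont : Continuous (𝓕 g) :=
    VectorFourier.fourierIntegral_continuous Real.continuous_fourierChar
      continuous_inner hg1
  refine ae_eq_of_integral_contDiff_smul_eq
    ((Lp.memLp _).locallyIntegrable (by norm_num)) hcont.locallyIntegrable ?_
  intro φ hφ hφc
  have hφc' : HasCompactSupport (fun x => (φ x : ℂ)) := hφc.comp_left (g := Complex.ofReal) rfl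
  let ψ : SchwartzMap ℝ ℂ := hφc'.toSchwartzMap (Complex.ofRealCLM.contDiff.comp hφ)
  have key := DFunLike.congr_fun (Lp.fourier_toTemperedDistribution_eq (hg2.toLp g)) ψ
  rw [TemperedDistribution.fourier_apply, Lp.toTemperedDistribution_apply,
    Lp.toTemperedDistribution_apply] at key
  have hflip : ∫ x, 𝓕 ψ x • g x = ∫ x, ψ x • 𝓕 g x := by
    simpa using! VectorFourier.integral_fourierIntegral_smul_eq_flip (L := innerₗ ℝ)
      Real.continuous_fourierChar continuous_inner ψ.integrable hg1
  calc ∫ x, φ x • (𝓕 (hg2.toLp g) : Lp ℂ 2 (volume : Measure ℝ)) x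
      = ∫ x, ψ x • (𝓕 (hg2.toLp g) : Lp ℂ 2 (volume : Measure ℝ)) x := rfl
    _ = ∫ x, 𝓕 ψ x • hg2.toLp g x := key.symm
    _ = ∫ x, 𝓕 ψ x • g x := by
      refine integral_congr_ae ?_
      filter_upwards [hg2.coeFn_toLp] with x hx
      rw [hx]
    _ = ∫ x, ψ x • 𝓕 g x := hflip
    _ = ∫ x, φ x • 𝓕 g x := rfl

/-- Squared `L²` norm as an integral. -/
theorem norm_sq_eq_integral_norm_sq (g : Lp ℂ 2 (volume : Measure ℝ)) :
    ‖g‖ ^ 2 = ∫ x, ‖g x‖ ^ 2 := by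
  apply Complex.ofRealLI.injective
  have := L2.inner_def (𝕜 := ℂ) g g
  simpa [← LinearIsometry.integral_comp_comm, inner_self_eq_norm_sq_to_K] using this

/-- Plancherel's theorem for `L¹ ∩ L²` functions. -/
theorem integral_norm_sq_fourier_eq {g : ℝ → ℂ} (hg1 : Integrable g) (hg2 : MemLp g 2) :
    ∫ x, ‖𝓕 g x‖ ^ 2 = ∫ x, ‖g x‖ ^ 2 := by
  have h := congrArg (· ^ 2) (Lp.norm_fourier_eq (hg2.toLp g))
  simp only [norm_sq_eq_integral_norm_sq] at h
  calc ∫ x, ‖𝓕 g x‖ ^ 2 = ∫ x, ‖(𝓕 (hg2.toLp g) : Lp ℂ 2 (volume : Measure ℝ)) x‖ ^ 2 := by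
        refine integral_congr_ae ?_
        filter_upwards [coeFn_fourier_toLp_ae_eq hg1 hg2] with x hx
        rw [hx]
    _ = ∫ x, ‖hg2.toLp g x‖ ^ 2 := h
    _ = ∫ x, ‖g x‖ ^ 2 := by
        refine integral_congr_ae ?_
        filter_upwards [hg2.coeFn_toLp] with x hx
        rw [hx]

theorem hasDerivWithinAt_exp_neg (x : ℝ) (s : Set ℝ) :
    HasDerivWithinAt (fun u => Real.exp (-u)) (-Real.exp (-x)) s x := by
  simpa using ((hasDerivAt_neg x).exp).hasDerivWithinAt

theorem image_exp_neg_univ : (fun u : ℝ => Real.exp (-u)) '' Set.univ = Set.Ioi 0 := by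
  rw [← Real.range_exp, Set.image_univ]
  exact neg_surjective.range_comp Real.exp

theorem injective_exp_neg : Function.Injective fun u : ℝ => Real.exp (-u) :=
  Real.exp_injective.comp neg_injective

/-- Substitution `x = exp (-u)` for integrability on `(0,∞)`. -/
theorem integrableOn_Ioi_iff_integrable_comp_exp_neg
    {E : Type*} [NormedAddCommGroup E] [NormedSpace ℝ E] (F : ℝ → E) :
    IntegrableOn F (Set.Ioi 0) ↔ Integrable fun u => Real.exp (-u) • F (Real.exp (-u)) := by
  rw [← image_exp_neg_univ, integrableOn_image_iff_integrableOn_abs_deriv_smul MeasurableSet.univ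
    (fun x _ => hasDerivWithinAt_exp_neg x _) injective_exp_neg.injOn]
  simp

/-- Substitution `x = exp (-u)` for integrals over `(0,∞)`. -/
theorem integral_Ioi_eq_integral_comp_exp_neg
    {E : Type*} [NormedAddCommGroup E] [NormedSpace ℝ E] (F : ℝ → E) :
    ∫ x in Set.Ioi 0, F x = ∫ u, Real.exp (-u) • F (Real.exp (-u)) := by
  rw [← image_exp_neg_univ, integral_image_eq_integral_abs_deriv_smul MeasurableSet.univ
    (fun x _ => hasDerivWithinAt_exp_neg x _) injective_exp_neg.injOn]
  simp

/-- Parseval's theorem for the Mellin transform: if `f/x ∈ L¹((0,∞))` and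
`∫_0^∞ |f(x)|²/x dx < ∞`, then
`∫_0^∞ |f(x)|²/x dx = (1/2π) ∫_ℝ |M[f](it)|² dt`. -/
theorem stmt_6 (f : ℝ → ℂ) (hmeas : Measurable f)
    (h1 : IntegrableOn (fun x : ℝ => f x / (x : ℂ)) (Set.Ioi 0))
    (h2 : IntegrableOn (fun x : ℝ => ‖f x‖ ^ 2 / x) (Set.Ioi 0)) :
    (∫ x in Set.Ioi (0:ℝ), ‖f x‖ ^ 2 / x)
      = (1 / (2 * Real.pi)) * ∫ t : ℝ, ‖mellin f (Complex.I * (t : ℂ))‖ ^ 2 := by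
  set g : ℝ → ℂ := fun u => f (Real.exp (-u)) with hg
  have hsq : ∀ u : ℝ, Real.exp (-u) • (‖f (Real.exp (-u))‖ ^ 2 / Real.exp (-u)) = ‖g u‖ ^ 2 :=
    fun u => by rw [smul_eq_mul, mul_div_cancel₀ _ (Real.exp_ne_zero _)]
  have hg1 : Integrable g := by
    rw [integrableOn_Ioi_iff_integrable_comp_exp_neg] at h1
    refine h1.congr (.of_forall fun u => ?_)
    have : (Real.exp (-u) : ℂ) ≠ 0 := Complex.ofReal_ne_zero.2 (Real.exp_ne_zero _)
    simp only [Complex.real_smul, hg]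
    rw [mul_div_cancel₀ _ this]
  have hgm : Measurable g := hmeas.comp (by fun_prop)
  have hg2 : MemLp g 2 := by
    rw [integrableOn_Ioi_iff_integrable_comp_exp_neg] at h2
    simp only [hsq] at h2
    exact (memLp_two_iff_integrable_sq_norm hgm.aestronglyMeasurable).2 h2
  have hmellin : ∀ t : ℝ, mellin f (Complex.I * t) = 𝓕 g (t / (2 * Real.pi)) := fun t => by
    simp [mellin_eq_fourier, hg]
  rw [integral_Ioi_eq_integral_comp_exp_neg]
  simp only [hsq, hmellin]
  rw [Measure.integral_comp_div (fun y => ‖𝓕 g y‖ ^ 2), integral_norm_sq_fourier_eq hg1 hg2,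
    abs_of_pos Real.two_pi_pos, smul_eq_mul, ← mul_assoc,
    one_div_mul_cancel Real.two_pi_pos.ne', one_mul]
end

section
/- Let d ≥ 1 be an integer and let f and f_n (n ∈ ℕ) be continuous functions from ℝ^d to ℂ∖{0} that never vanish and satisfy f(0) = f_n(0) = 1 for all n. If (f_n) converges to f uniformly on every compact subset of ℝ^d, then the sequence of distinguished logarithms (log f_n) converges to log f uniformly on every compact subset of ℝ^d. -/
/-- On a compact preconnected set, continuous functions that agree at one point converge
uniformly as soon as their exponentials do. -/
theorem IsCompact.tendstoUniformlyOn_of_cexp {X ι : Type*} [TopologicalSpace X] {l : Filter ι}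
    {S : Set X} (hS : IsCompact S) (hconn : IsPreconnected S) {x₀ : X} (hx₀ : x₀ ∈ S)
    {u : X → ℂ} {v : ι → X → ℂ} (hu : ContinuousOn u S) (hv : ∀ i, ContinuousOn (v i) S)
    (h₀ : ∀ i, v i x₀ = u x₀)
    (hexp : TendstoUniformlyOn (fun i x => Complex.exp (v i x)) (fun x => Complex.exp (u x)) l S) :
    TendstoUniformlyOn v u l S := by
  rw [Metric.tendstoUniformlyOn_iff] at hexp ⊢
  intro ε hε
  obtain ⟨r, hr0, hr⟩ : ∃ r : ℝ, 0 < r ∧ r < min ε 1 := exists_between (lt_min hε one_pos)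
  obtain ⟨hrε, hr1⟩ := lt_min_iff.mp hr
  obtain ⟨y, -, hy⟩ := hS.exists_isMinOn ⟨x₀, hx₀⟩ hu.cexp.norm
  have hm : 0 < ‖Complex.exp (u y)‖ := norm_pos_iff.mpr (Complex.exp_ne_zero _)
  have hδ : 0 < (r - r ^ 2) * ‖Complex.exp (u y)‖ := mul_pos (by nlinarith) hm
  filter_upwards [hexp _ hδ] with i hi x hx
  rw [dist_eq_norm, norm_sub_rev]
  by_contra! hle
  have hcont : ContinuousOn (fun x => ‖v i x - u x‖) S := ((hv i).sub hu).norm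
  obtain ⟨z, hz, hzr⟩ := hconn.intermediate_value hx₀ hx hcont
    (show r ∈ Set.Icc _ _ from ⟨by simp [h₀ i, hr0.le], hrε.le.trans hle⟩)
  simp only at hzr
  have hquad := Complex.norm_exp_sub_one_sub_id_le (hzr.le.trans hr1.le)
  have htri := norm_sub_norm_le (v i z - u z) (Complex.exp (v i z - u z) - 1)
  rw [norm_sub_rev (v i z - u z)] at htri
  rw [hzr] at hquad htri
  have hlow : r - r ^ 2 ≤ ‖Complex.exp (v i z - u z) - 1‖ := by linarith
  have hfac : Complex.exp (v i z) - Complex.exp (u z)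
      = (Complex.exp (v i z - u z) - 1) * Complex.exp (u z) := by
    rw [sub_mul, ← Complex.exp_add, sub_add_cancel, one_mul]
  have hlt := hi z hz
  rw [dist_eq_norm, norm_sub_rev, hfac, norm_mul] at hlt
  exact hlt.not_ge (mul_le_mul hlow (hy hz) hm.le (norm_nonneg _))

/-- If never-vanishing continuous functions `fₙ` (with `fₙ 0 = 1`) converge to `f`
uniformly on compact sets, then their distinguished logarithms converge to the
distinguished logarithm of `f` uniformly on compact sets. -/
theorem stmt_13 (d : ℕ) (hd : 1 ≤ d)
    (f : (Fin d → ℝ) → ℂ) (fn : ℕ → (Fin d → ℝ) → ℂ)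
    (hf : Continuous f) (hfn : ∀ n, Continuous (fn n))
    (hfne : ∀ x, f x ≠ 0) (hfnne : ∀ n x, fn n x ≠ 0)
    (hf0 : f 0 = 1) (hfn0 : ∀ n, fn n 0 = 1)
    (ψ : (Fin d → ℝ) → ℂ) (ψn : ℕ → (Fin d → ℝ) → ℂ)
    (hψcont : Continuous ψ) (hψ0 : ψ 0 = 0) (hψexp : ∀ x, Complex.exp (ψ x) = f x)
    (hψncont : ∀ n, Continuous (ψn n)) (hψn0 : ∀ n, ψn n 0 = 0)
    (hψnexp : ∀ n x, Complex.exp (ψn n x) = fn n x)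
    (hconv : ∀ K : Set (Fin d → ℝ), IsCompact K → TendstoUniformlyOn fn f Filter.atTop K) :
    ∀ K : Set (Fin d → ℝ), IsCompact K → TendstoUniformlyOn ψn ψ Filter.atTop K := by
  intro K hK
  obtain ⟨R, hR0, hR⟩ := hK.isBounded.subset_closedBall_lt 0 0
  refine TendstoUniformlyOn.mono ?_ hR
  have hB : IsCompact (Metric.closedBall (0 : Fin d → ℝ) R) := isCompact_closedBall 0 R
  refine hB.tendstoUniformlyOn_of_cexp (convex_closedBall 0 R).isPreconnected
    (Metric.mem_closedBall_self hR0.le) hψcont.continuousOn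
    (fun n => (hψncont n).continuousOn) (fun n => by rw [hψn0, hψ0]) ?_
  simpa only [hψnexp, hψexp] using hconv _ hB
end
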